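/- arXiv:1602.06622 — 3 statements merged into one kernel-verified Lean document; each statement's English description precedes it below -/
import Mathlib

section
/- Let G be a minimal non-mock-threshold graph. Then G does not contain three distinct divalent vertices (vertices of degree 2) that all have the same neighborhood. -/
/-- The degree of the `i`-th vertex of the ordering `v` within the prefix
`{v 0, …, v i}`, i.e. the number of earlier vertices adjacent to `v i`. -/
noncomputable def prefixDegree {n : ℕ} {V : Type*} (G : SimpleGraph V) (v : Fin n ≃ V)
    (i : Fin n) : ℕ :=
  Nat.card {j : Fin n // j < i ∧ G.Adj (v i) (v j)}

/-- A finite simple graph is mock threshold if there is an ordering `v 0, …, v (n-1)` of its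
vertices such that each `v i` has degree `0`, `1`, `(i+1)-2`, or `(i+1)-1` in the subgraph
induced on `{v 0, …, v i}` (a prefix of `i+1` vertices). -/
def IsMockThreshold {V : Type*} [Fintype V] (G : SimpleGraph V) : Prop :=
  ∃ v : Fin (Fintype.card V) ≃ V, ∀ i : Fin (Fintype.card V),
    prefixDegree G v i = 0 ∨ prefixDegree G v i = 1 ∨
    prefixDegree G v i = (i : ℕ) - 1 ∨ prefixDegree G v i = (i : ℕ)

/-- A graph is a minimal non-mock-threshold graph if it is not mock threshold but every
proper induced subgraph of it is mock threshold. -/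
def IsMinimalNonMockThreshold {V : Type*} [Fintype V] (G : SimpleGraph V) : Prop :=
  ¬ IsMockThreshold G ∧
    ∀ X : Finset V, X ≠ Finset.univ → IsMockThreshold (G.induce (X : Set V))

open scoped Classical in
/-- `MockThresholdOn G s` says that the vertices of `s` can be listed so that each one is adjacent
to at most one, or to all but at most one, of the vertices preceding it. -/
inductive MockThresholdOn {V : Type*} (G : SimpleGraph V) : Finset V → Prop
  | empty : MockThresholdOn G ∅
  | cons (w : V) (s : Finset V) (hs : MockThresholdOn G s) (hw : w ∉ s)
      (h : (s.filter (G.Adj w)).card ≤ 1 ∨ s.card ≤ (s.filter (G.Adj w)).card + 1) :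
      MockThresholdOn G (insert w s)

open scoped Classical in
theorem MockThresholdOn.of_induce {V : Type*} (G : SimpleGraph V) (X : Finset V)
    (h : IsMockThreshold (G.induce (X : Set V))) : MockThresholdOn G X := by
  rw [IsMockThreshold] at h
  generalize Fintype.card (X : Set V) = n at h
  obtain ⟨v, hv⟩ := h
  have key : ∀ k ≤ n, MockThresholdOn G
      ((Finset.univ.filter fun i : Fin n => (i : ℕ) < k).image fun i => (v i : V)) := by
    intro k
    induction k with
    | zero =>
      intro _
      simpa using MockThresholdOn.empty
    | succ k ih =>
      intro hk
      have inj : Function.Injective fun i => (v i : V) :=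
        Subtype.val_injective.comp v.injective
      have hset : (Finset.univ.filter fun i : Fin n => (i : ℕ) < k + 1)
          = insert ⟨k, hk⟩ (Finset.univ.filter fun i : Fin n => (i : ℕ) < k) := by
        ext i
        simp only [Finset.mem_filter, Finset.mem_univ, true_and, Finset.mem_insert, Fin.ext_iff]
        omega
      rw [hset, Finset.image_insert]
      refine MockThresholdOn.cons _ _ (ih (by omega)) ?_ ?_
      · intro hmem
        obtain ⟨i, hi, hi'⟩ := Finset.mem_image.1 hmem
        have := inj hi'
        subst this
        simp at hi
      · have hcard : (Finset.univ.filter fun i : Fin n => (i : ℕ) < k).card = k := by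
          rw [Fin.card_filter_val_lt]
          omega
        have hdeg : prefixDegree (G.induce (X : Set V)) v ⟨k, hk⟩ =
            (((Finset.univ.filter fun i : Fin n => (i : ℕ) < k).image
              fun i => (v i : V)).filter (G.Adj (v ⟨k, hk⟩))).card := by
          rw [Finset.filter_image, Finset.card_image_of_injective _ inj, prefixDegree,
            Nat.card_eq_fintype_card, Fintype.card_subtype, Finset.filter_filter]
          congr 1
        rw [← hdeg, Finset.card_image_of_injective _ inj, hcard]
        have := hv ⟨k, hk⟩
        simp only at this
        omega
  have hX := key n le_rfl
  convert hX using 1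
  ext a
  simp only [Finset.mem_image, Finset.mem_filter, Finset.mem_univ, true_and, Fin.is_lt]
  exact ⟨fun ha => ⟨v.symm ⟨a, ha⟩, by simp⟩, fun ⟨i, hi⟩ => hi ▸ (v i).2⟩

open scoped Classical in
theorem MockThresholdOn.exists_enumeration {V : Type*} [Nonempty V] {G : SimpleGraph V}
    {s : Finset V} (h : MockThresholdOn G s) :
    ∃ f : ℕ → V, Set.InjOn f (Set.Iio s.card) ∧ (Finset.range s.card).image f = s ∧
      ∀ i < s.card, ((Finset.range i).filter fun j => G.Adj (f i) (f j)).card ≤ 1 ∨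
        i ≤ ((Finset.range i).filter fun j => G.Adj (f i) (f j)).card + 1 := by
  induction h with
  | empty => exact ⟨fun _ => Classical.arbitrary V, by simp⟩
  | cons w s _ hw hdeg ih =>
    obtain ⟨f, hinj, himg, hf⟩ := ih
    have hlt : ∀ j < s.card, Function.update f s.card w j = f j := fun j hj =>
      Function.update_of_ne hj.ne _ _
    have hmem : ∀ j < s.card, f j ∈ s := fun j hj =>
      himg.subset (Finset.mem_image_of_mem f (Finset.mem_range.2 hj))
    refine ⟨Function.update f s.card w, ?_, ?_, ?_⟩
    · rw [Finset.card_insert_of_notMem hw]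
      intro i hi j hj hij
      simp only [Set.mem_Iio, Order.lt_add_one_iff] at hi hj
      rcases hi.lt_or_eq with hi | rfl <;> rcases hj.lt_or_eq with hj | rfl
      · rw [hlt i hi, hlt j hj] at hij
        exact hinj hi hj hij
      · rw [hlt i hi, Function.update_self] at hij
        exact absurd (hij ▸ hmem i hi) hw
      · rw [hlt j hj, Function.update_self] at hij
        exact absurd (hij ▸ hmem j hj) hw
      · rfl
    · rw [Finset.card_insert_of_notMem hw, Finset.range_add_one, Finset.image_insert,
        Function.update_self]
      congr 1
      conv_rhs => rw [← himg]
      exact Finset.image_congr fun j hj => hlt j (by simpa using hj)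
    · rw [Finset.card_insert_of_notMem hw]
      intro i hi
      have hfilter : ((Finset.range i).filter fun j =>
          G.Adj (Function.update f s.card w i) (Function.update f s.card w j)) =
          (Finset.range i).filter fun j => G.Adj (Function.update f s.card w i) (f j) :=
        Finset.filter_congr fun j hj => by
          rw [hlt j (by have := Finset.mem_range.1 hj; omega)]
      rw [hfilter]
      rcases (Nat.lt_succ_iff.1 hi).lt_or_eq with hi | rfl
      · rw [hlt i hi]
        exact hf i hi
      · rw [Function.update_self]
        have hcard : (s.filter (G.Adj w)).card =
            ((Finset.range s.card).filter fun j => G.Adj w (f j)).card := by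
          conv_lhs => rw [← himg]
          rw [Finset.filter_image, Finset.card_image_of_injOn]
          exact hinj.mono fun j hj => by simpa using (Finset.mem_filter.1 hj).1
        rwa [hcard] at hdeg

open scoped Classical in
theorem MockThresholdOn.isMockThreshold {V : Type*} [Fintype V] [Nonempty V] {G : SimpleGraph V}
    (h : MockThresholdOn G Finset.univ) : IsMockThreshold G := by
  obtain ⟨f, hinj, himg, hf⟩ := h.exists_enumeration
  rw [Finset.card_univ] at hinj himg hf
  have hbij : Function.Bijective fun i : Fin (Fintype.card V) => f i := by
    rw [Fintype.bijective_iff_injective_and_card]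
    exact ⟨fun i j hij => Fin.ext (hinj i.2 j.2 hij), by simp⟩
  refine ⟨Equiv.ofBijective _ hbij, fun i => ?_⟩
  have hdeg : prefixDegree G (Equiv.ofBijective _ hbij) i =
      ((Finset.range i).filter fun j => G.Adj (f i) (f j)).card := by
    rw [prefixDegree, Nat.card_eq_fintype_card, Fintype.card_subtype,
      ← Finset.card_map Fin.valEmbedding]
    congr 1
    ext j
    simp only [Finset.mem_map, Finset.mem_filter, Finset.mem_univ, true_and, Finset.mem_range,
      Equiv.ofBijective_apply, Fin.valEmbedding_apply]
    constructor
    · rintro ⟨k, ⟨hk, hadj⟩, rfl⟩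
      exact ⟨hk, hadj⟩
    · rintro ⟨hj, hadj⟩
      exact ⟨⟨j, hj.trans i.2⟩, ⟨hj, hadj⟩, rfl⟩
  have hle : ((Finset.range i).filter fun j => G.Adj (f i) (f j)).card ≤ i := by
    simpa using Finset.card_filter_le (Finset.range (i : ℕ)) fun j => G.Adj (f i) (f j)
  have := hf i i.2
  omega

open scoped Classical in
/-- A vertex with neighborhood `{a, b}` sees at most one vertex of a set missing `a` or `b`. -/
theorem card_filter_adj_le_one {V : Type*} {G : SimpleGraph V} {a b z : V} {s : Finset V}
    (hz : ∀ v, G.Adj z v ↔ v = a ∨ v = b) (hs : a ∉ s ∨ b ∉ s) :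
    (s.filter (G.Adj z)).card ≤ 1 := by
  rw [Finset.card_le_one]
  simp only [Finset.mem_filter, hz]
  grind

open scoped Classical in
/-- Three vertices with common neighborhood `{a, b}` induce, together with `a` and `b`, a mock
threshold graph. -/
theorem mockThresholdOn_three_twins {V : Type*} {G : SimpleGraph V} {a b x y z : V}
    (hab : a ≠ b) (hxy : x ≠ y) (hyz : y ≠ z) (hxz : x ≠ z)
    (hx : ∀ v, G.Adj x v ↔ v = a ∨ v = b) (hy : ∀ v, G.Adj y v ↔ v = a ∨ v = b)
    (hz : ∀ v, G.Adj z v ↔ v = a ∨ v = b) : MockThresholdOn G {a, z, x, y, b} := by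
  have hax : a ≠ x := ((hx a).2 (Or.inl rfl)).ne'
  have hay : a ≠ y := ((hy a).2 (Or.inl rfl)).ne'
  have haz : a ≠ z := ((hz a).2 (Or.inl rfl)).ne'
  have hbx : b ≠ x := ((hx b).2 (Or.inr rfl)).ne'
  have hby : b ≠ y := ((hy b).2 (Or.inr rfl)).ne'
  have hbz : b ≠ z := ((hz b).2 (Or.inr rfl)).ne'
  have h1 : MockThresholdOn G (insert b ∅) := .cons b ∅ .empty (by simp) (by simp)
  have h2 := h1.cons y _ (by grind) (Or.inl (card_filter_adj_le_one hy (by grind)))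
  have h3 := h2.cons x _ (by grind) (Or.inl (card_filter_adj_le_one hx (by grind)))
  have h4 := h3.cons z _ (by grind) (Or.inl (card_filter_adj_le_one hz (by grind)))
  refine h4.cons a _ (by grind) (Or.inr ?_)
  have hsub : ({z, x, y} : Finset V) ⊆
      Finset.filter (G.Adj a) (insert z (insert x (insert y (insert b ∅)))) := by
    intro v hv
    simp only [Finset.mem_insert, Finset.mem_singleton] at hv
    rcases hv with rfl | rfl | rfl <;> simp [G.adj_comm a, hx, hy, hz]
  have h5 : ({z, x, y} : Finset V).card = 3 :=
    Finset.card_eq_three.2 ⟨z, x, y, hxz.symm, hyz.symm, hxy, rfl⟩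
  have h6 := Finset.card_le_card hsub
  have h7 : (insert z (insert x (insert y (insert b (∅ : Finset V))))).card ≤ 4 :=
    Finset.card_le_four
  omega

open scoped Classical in
/-- If a vertex with neighborhood `{a, b}` can be added last to a set containing `a`, `b` and `y`,
then the set has no further elements. -/
theorem eq_of_divalent_added_last {V : Type*} {G : SimpleGraph V} {a b x y : V} {s : Finset V}
    (hab : a ≠ b) (hx : ∀ v, G.Adj x v ↔ v = a ∨ v = b) (hay : a ≠ y) (hby : b ≠ y)
    (ha : a ∈ s) (hb : b ∈ s) (hy : y ∈ s)
    (h : (s.filter (G.Adj x)).card ≤ 1 ∨ s.card ≤ (s.filter (G.Adj x)).card + 1) :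
    s = {a, y, b} := by
  have hf : s.filter (G.Adj x) = {a, b} := by
    ext v
    simp only [Finset.mem_filter, hx, Finset.mem_insert, Finset.mem_singleton]
    grind
  rw [hf, Finset.card_pair hab] at h
  have hsub : ({a, y, b} : Finset V) ⊆ s := by
    intro v hv
    simp only [Finset.mem_insert, Finset.mem_singleton] at hv
    rcases hv with rfl | rfl | rfl <;> assumption
  have h3 : ({a, y, b} : Finset V).card = 3 :=
    Finset.card_eq_three.2 ⟨a, y, b, hay, hab, hby.symm, rfl⟩
  exact (Finset.eq_of_subset_of_card_le hsub (by omega)).symm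

open scoped Classical in
/-- A third vertex with neighborhood `{a, b}` can be added to a mock threshold set containing two
such vertices. -/
theorem MockThresholdOn.insert_third_twin {V : Type*} {G : SimpleGraph V} {a b x y z : V}
    (hab : a ≠ b) (hxy : x ≠ y) (hyz : y ≠ z) (hxz : x ≠ z)
    (hx : ∀ v, G.Adj x v ↔ v = a ∨ v = b) (hy : ∀ v, G.Adj y v ↔ v = a ∨ v = b)
    (hz : ∀ v, G.Adj z v ↔ v = a ∨ v = b) {s : Finset V} (h : MockThresholdOn G s)
    (hzs : z ∉ s) (hxs : x ∈ s) (hys : y ∈ s) : MockThresholdOn G (insert z s) := by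
  have hax : a ≠ x := ((hx a).2 (Or.inl rfl)).ne'
  have hay : a ≠ y := ((hy a).2 (Or.inl rfl)).ne'
  have haz : a ≠ z := ((hz a).2 (Or.inl rfl)).ne'
  have hbx : b ≠ x := ((hx b).2 (Or.inr rfl)).ne'
  have hby : b ≠ y := ((hy b).2 (Or.inr rfl)).ne'
  have hbz : b ≠ z := ((hz b).2 (Or.inr rfl)).ne'
  induction h with
  | empty => simp at hxs
  | cons w s hs hw hdeg ih =>
    by_cases hmiss : a ∉ insert w s ∨ b ∉ insert w s
    · exact (hs.cons w s hw hdeg).cons z _ hzs (Or.inl (card_filter_adj_le_one hz hmiss))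
    push Not at hmiss
    obtain ⟨ha, hb⟩ := hmiss
    rw [Finset.mem_insert] at ha hb hxs hys
    have hzw : z ≠ w := fun h => hzs (h ▸ Finset.mem_insert_self _ _)
    have hzs' : z ∉ s := fun h => hzs (Finset.mem_insert_of_mem h)
    by_cases hwx : w = x
    · subst hwx
      have := eq_of_divalent_added_last hab hx hay hby (by grind) (by grind) (by grind) hdeg
      subst this
      convert mockThresholdOn_three_twins hab hxy hyz hxz hx hy hz using 1
      grind
    by_cases hwy : w = y
    · subst hwy
      have := eq_of_divalent_added_last hab hy hax hbx (by grind) (by grind) (by grind) hdeg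
      subst this
      convert mockThresholdOn_three_twins hab hxy hyz hxz hx hy hz using 1
      grind
    replace hxs : x ∈ s := by grind
    replace hys : y ∈ s := by grind
    rw [Finset.insert_comm]
    have hwzs : w ∉ insert z s := by grind
    by_cases hwab : w = a ∨ w = b
    · refine (hs.cons z s hzs' (Or.inl (card_filter_adj_le_one hz (by grind)))).cons w _
        hwzs (Or.inr ?_)
      rw [Finset.filter_insert, if_pos ((G.adj_comm _ _).1 ((hz w).2 hwab)),
        Finset.card_insert_of_notMem hzs', Finset.card_insert_of_notMem (by simp [hzs'])]
      have hsub : ({x, y} : Finset V) ⊆ s.filter (G.Adj w) := by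
        intro v hv
        simp only [Finset.mem_insert, Finset.mem_singleton] at hv
        rcases hv with rfl | rfl
        · simp [hxs, G.adj_comm w, hx, hwab]
        · simp [hys, G.adj_comm w, hy, hwab]
      have := Finset.card_le_card hsub
      rw [Finset.card_pair hxy] at this
      omega
    · refine (ih hzs' hxs hys).cons w _ hwzs (Or.inl ?_)
      rw [Finset.filter_insert, if_neg (by rwa [G.adj_comm, hz])]
      refine hdeg.resolve_right fun hco => ?_
      have hsub : ({x, y} : Finset V) ⊆ s.filter fun v => ¬ G.Adj w v := by
        intro v hv
        simp only [Finset.mem_insert, Finset.mem_singleton] at hv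
        rcases hv with rfl | rfl
        · simpa [hxs, G.adj_comm w, hx] using hwab
        · simpa [hys, G.adj_comm w, hy] using hwab
      have h1 := Finset.card_le_card hsub
      rw [Finset.card_pair hxy] at h1
      have h2 := Finset.card_filter_add_card_filter_not (s := s) (G.Adj w)
      omega

theorem minimal_nonMockThreshold_no_three_divalent_same_neighborhood {V : Type*} [Fintype V]
    (G : SimpleGraph V) [DecidableRel G.Adj] (hG : IsMinimalNonMockThreshold G) :
    ¬ ∃ x y z : V, x ≠ y ∧ y ≠ z ∧ x ≠ z ∧
      G.degree x = 2 ∧ G.degree y = 2 ∧ G.degree z = 2 ∧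
      G.neighborSet x = G.neighborSet y ∧ G.neighborSet y = G.neighborSet z := by
  classical
  rintro ⟨x, y, z, hxy, hyz, hxz, hdeg, -, -, hNxy, hNyz⟩
  obtain ⟨a, b, hab, hN⟩ := Finset.card_eq_two.1 hdeg
  have hx : ∀ v, G.Adj x v ↔ v = a ∨ v = b := fun v => by
    rw [← G.mem_neighborFinset, hN, Finset.mem_insert, Finset.mem_singleton]
  have hy : ∀ v, G.Adj y v ↔ v = a ∨ v = b := fun v => by
    rw [← hx, ← G.mem_neighborSet, ← hNxy, G.mem_neighborSet]
  have hz : ∀ v, G.Adj z v ↔ v = a ∨ v = b := fun v => by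
    rw [← hy, ← G.mem_neighborSet, ← hNyz, G.mem_neighborSet]
  have : Nonempty V := ⟨x⟩
  have hne : Finset.univ.erase z ≠ Finset.univ := fun h =>
    Finset.erase_eq_self.1 h (Finset.mem_univ z)
  have hX : MockThresholdOn G (Finset.univ.erase z) :=
    MockThresholdOn.of_induce G _ (by convert hG.2 _ hne)
  have huniv := hX.insert_third_twin hab hxy hyz hxz hx hy hz (Finset.notMem_erase _ _)
    (by simp [hxz]) (by simp [hyz])
  rw [Finset.insert_erase (Finset.mem_univ z)] at huniv
  exact hG.1 huniv.isMockThreshold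
end

section
/- Let G be a minimal non-mock-threshold graph with vertex set V(G), and let X be a nonempty subset of V(G) such that every vertex in X has at least two neighbors in X and at least two non-neighbors in X. Then X = V(G). -/
theorem prefixDegree_of_forall_le {n : ℕ} {V : Type*} (G : SimpleGraph V) (v : Fin n ≃ V)
    {i : Fin n} (hi : ∀ j, j ≤ i) : prefixDegree G v i = Nat.card {w // G.Adj (v i) w} := by
  refine Nat.card_congr (v.subtypeEquiv fun j => ⟨And.right, fun hj => ⟨?_, hj⟩⟩)
  refine lt_of_le_of_ne (hi j) ?_
  rintro rfl
  exact G.loopless.irrefl _ hj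

theorem SimpleGraph.card_adj_add_card_not_adj {V : Type*} [Fintype V] (G : SimpleGraph V)
    (x : V) :
    Nat.card {w // G.Adj x w} + Nat.card {w // w ≠ x ∧ ¬ G.Adj x w} + 1 = Fintype.card V := by
  classical
  have hnot : Finset.univ.filter (fun w => ¬ G.Adj x w) =
      insert x (Finset.univ.filter fun w => w ≠ x ∧ ¬ G.Adj x w) := by
    ext w
    by_cases hw : w = x <;> simp [hw]
  have hsum := Finset.card_filter_add_card_filter_not
    (s := (Finset.univ : Finset V)) (fun w => G.Adj x w)
  rw [hnot, Finset.card_insert_of_notMem (by simp), Finset.card_univ] at hsum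
  simp only [Nat.card_eq_fintype_card, Fintype.card_subtype]
  omega

/-- A nonempty mock threshold graph has a vertex with at most one neighbor or at most one
non-neighbor. -/
theorem IsMockThreshold.exists_card_le_one {V : Type*} [Fintype V] [Nonempty V]
    {G : SimpleGraph V} (hG : IsMockThreshold G) :
    ∃ x : V, Nat.card {w // G.Adj x w} ≤ 1 ∨ Nat.card {w // w ≠ x ∧ ¬ G.Adj x w} ≤ 1 := by
  obtain ⟨v, hv⟩ := hG
  have hpos : 0 < Fintype.card V := Fintype.card_pos
  let i : Fin (Fintype.card V) := ⟨Fintype.card V - 1, by omega⟩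
  have hi : ∀ j, j ≤ i := fun j => Fin.le_def.2 (Nat.le_sub_one_of_lt j.isLt)
  have hdeg := hv i
  rw [prefixDegree_of_forall_le G v hi] at hdeg
  have hsum := G.card_adj_add_card_not_adj (v i)
  have hval : (i : ℕ) = Fintype.card V - 1 := rfl
  exact ⟨v i, by omega⟩

theorem Finset.natCard_subtype_coe {V : Type*} (X : Finset V) (p : V → Prop)
    [DecidablePred p] : Nat.card {w : (X : Set V) // p w} = (X.filter p).card := by
  rw [← Nat.card_eq_finsetCard]
  exact Nat.card_congr ((Equiv.subtypeSubtypeEquivSubtypeInter (· ∈ X) p).trans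
    (Equiv.subtypeEquivRight fun w => Finset.mem_filter.symm))

theorem minimal_nonMockThreshold_full_set {V : Type*} [Fintype V] [DecidableEq V]
    (G : SimpleGraph V) [DecidableRel G.Adj] (hG : IsMinimalNonMockThreshold G)
    (X : Finset V) (hX : X.Nonempty)
    (h : ∀ v ∈ X, 2 ≤ (X.filter (fun w => G.Adj v w)).card ∧
      2 ≤ (X.filter (fun w => w ≠ v ∧ ¬ G.Adj v w)).card) :
    X = Finset.univ := by
  by_contra hne
  have : Nonempty (X : Set V) := hX.to_subtype
  obtain ⟨⟨x, hx⟩, hcard⟩ := (hG.2 X hne).exists_card_le_one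
  have hadj := X.natCard_subtype_coe fun w => G.Adj x w
  have hnadj := X.natCard_subtype_coe fun w => w ≠ x ∧ ¬ G.Adj x w
  simp only [SimpleGraph.comap_adj, Function.Embedding.subtype_apply, ne_eq, Subtype.ext_iff]
    at hcard hadj hnadj
  have := h x hx
  simp only [ne_eq] at this
  omega
end

section
/- Every mock threshold graph on n vertices contains a clique or a stable (independent) set of size at least n/4. -/
/-- If every vertex of `A` has at most one smaller neighbour, then `A` is properly 2-colourable. -/
theorem exists_bool_coloring_of_unique_smaller_neighbor {α : Type*} [LinearOrder α]
    (H : SimpleGraph α) (A : Finset α)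
    (hA : ∀ i ∈ A, ∀ j k, j < i → k < i → H.Adj i j → H.Adj i k → j = k) :
    ∃ c : α → Bool, ∀ x ∈ A, ∀ y ∈ A, H.Adj x y → c x ≠ c y := by
  induction A using Finset.induction_on_max with
  | empty => exact ⟨fun _ => true, by simp⟩
  | insert a s hs ih =>
    obtain ⟨c, hc⟩ := ih fun i hi => hA i (Finset.mem_insert_of_mem hi)
    obtain ⟨b, hb⟩ : ∃ b : Bool, ∀ y ∈ s, H.Adj a y → b ≠ c y := by
      by_cases h : ∃ j ∈ s, H.Adj a j
      · obtain ⟨j, hj, haj⟩ := h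
        refine ⟨!c j, fun y hy hay => ?_⟩
        rw [hA a (Finset.mem_insert_self a s) y j (hs y hy) (hs j hj) hay haj]
        simp
      · exact ⟨true, fun y hy hay => (h ⟨y, hy, hay⟩).elim⟩
    refine ⟨Function.update c a b, fun x hx y hy hxy => ?_⟩
    rcases Finset.mem_insert.1 hx with rfl | hxs
    · rcases Finset.mem_insert.1 hy with rfl | hys
      · exact (H.irrefl hxy).elim
      · simpa [(hs y hys).ne] using hb y hys hxy
    · rcases Finset.mem_insert.1 hy with rfl | hys
      · simpa [(hs x hxs).ne] using (hb x hxs hxy.symm).symm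
      · simpa [(hs x hxs).ne, (hs y hys).ne] using hc x hxs y hys hxy

/-- If every vertex of `A` has at most one smaller neighbour, then some stable set contains at
least half as many vertices as `A`. -/
theorem exists_compl_isClique_of_unique_smaller_neighbor {α : Type*} [LinearOrder α]
    (H : SimpleGraph α) (A : Finset α)
    (hA : ∀ i ∈ A, ∀ j k, j < i → k < i → H.Adj i j → H.Adj i k → j = k) :
    ∃ S : Finset α, Hᶜ.IsClique (S : Set α) ∧ A.card ≤ 2 * S.card := by
  obtain ⟨c, hc⟩ := exists_bool_coloring_of_unique_smaller_neighbor H A hA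
  have hclique (b : Bool) : Hᶜ.IsClique (A.filter (c · = b) : Set α) := by
    intro x hx y hy hxy
    simp only [Finset.coe_filter, Set.mem_ofPred_eq] at hx hy
    exact (SimpleGraph.compl_adj ..).2
      ⟨hxy, fun h => hc x hx.1 y hy.1 h (hx.2.trans hy.2.symm)⟩
  have hcard := Finset.card_filter_add_card_filter_not (s := A) (c · = true)
  simp only [Bool.not_eq_true] at hcard
  rcases le_total (A.filter (c · = true)).card (A.filter (c · = false)).card with h | h
  · exact ⟨_, hclique false, by omega⟩
  · exact ⟨_, hclique true, by omega⟩

theorem mockThreshold_clique_or_stable {V : Type*} [Fintype V] (G : SimpleGraph V)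
    (hG : IsMockThreshold G) :
    ∃ S : Finset V, (G.IsClique (S : Set V) ∨ Gᶜ.IsClique (S : Set V)) ∧
      Fintype.card V ≤ 4 * S.card := by
  classical
  obtain ⟨v, hv⟩ := hG
  set H := G.comap v with hH
  have hdeg (i) : prefixDegree G v i =
      ((Finset.Iio i).filter fun j => G.Adj (v i) (v j)).card := by
    rw [prefixDegree, Nat.card_eq_fintype_card]
    exact Fintype.card_of_subtype _ (by simp)
  set A := Finset.univ.filter fun i => prefixDegree G v i ≤ 1 with hA
  obtain ⟨S, hS, hScard⟩ := exists_compl_isClique_of_unique_smaller_neighbor H A (by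
    intro i hi j k hj hk hij hik
    rw [hA, Finset.mem_filter, hdeg] at hi
    exact Finset.card_le_one.1 hi.2 j (by simpa [hj, hH] using hij)
      k (by simpa [hk, hH] using hik))
  obtain ⟨T, hT, hTcard⟩ := exists_compl_isClique_of_unique_smaller_neighbor Hᶜ Aᶜ (by
    intro i hi j k hj hk hij hik
    have hi : 1 < prefixDegree G v i := by simpa [hA] using hi
    have hcard := Finset.card_filter_add_card_filter_not (s := Finset.Iio i)
      (fun j => G.Adj (v i) (v j))
    rw [← hdeg, Fin.card_Iio] at hcard
    have hle : ((Finset.Iio i).filter fun j => ¬ G.Adj (v i) (v j)).card ≤ 1 := by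
      have := hv i
      omega
    exact Finset.card_le_one.1 hle j (by simpa [hj, hH] using hij.2)
      k (by simpa [hk, hH] using hik.2))
  rw [compl_compl] at hT
  have hsum := A.card_add_card_compl
  rw [Fintype.card_fin] at hsum
  rcases le_total S.card T.card with h | h
  · refine ⟨T.map v.toEmbedding, Or.inl ?_, by rw [Finset.card_map]; omega⟩
    rw [Finset.coe_map]
    rintro _ ⟨x, hx, rfl⟩ _ ⟨y, hy, rfl⟩ hxy
    exact hT hx hy (ne_of_apply_ne _ hxy)
  · refine ⟨S.map v.toEmbedding, Or.inr ?_, by rw [Finset.card_map]; omega⟩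
    rw [Finset.coe_map]
    rintro _ ⟨x, hx, rfl⟩ _ ⟨y, hy, rfl⟩ hxy
    exact (SimpleGraph.compl_adj ..).2 ⟨hxy, (hS hx hy (ne_of_apply_ne _ hxy)).2⟩
end
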